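/- Let A ⊆ Z be monotone with D(A) = X. Then h_A(z) ≥ p(z) for every z ∈ Z, and {z ∈ Z : h_A(z) = p(z)} is the unique maximal monotone extension of A in Z: it is maximal monotone, it contains A, and every maximal monotone set containing A is equal to it. -/

import Mathlib

open Pointwise Filter Topology

noncomputable section

variable {E F : Type*} [NormedAddCommGroup E] [NormedSpace ℝ E]
  [NormedAddCommGroup F] [NormedSpace ℝ F]

/-- Duality pairing `p(x, x*) = x*(x)` on `E × E*`. -/
def pairing (z : E × (E →L[ℝ] ℝ)) : ℝ := z.2 z.1

/-- Natural dual product `(x,x*)·(y,y*) = x*(y) + y*(x)`. -/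
def dprod (z w : E × (E →L[ℝ] ℝ)) : ℝ := z.2 w.1 + w.2 z.1

/-- A (graph of a) multivalued operator is monotone. -/
def MonotoneSet (A : Set (E × (E →L[ℝ] ℝ))) : Prop :=
  ∀ a ∈ A, ∀ b ∈ A, 0 ≤ (a.2 - b.2) (a.1 - b.1)

/-- Maximal monotone: monotone and maximal with respect to inclusion among monotone sets. -/
def MaximalMonotoneSet (A : Set (E × (E →L[ℝ] ℝ))) : Prop :=
  MonotoneSet A ∧ ∀ B, MonotoneSet B → A ⊆ B → A = B

/-- Fitzpatrick function `h_A(z) = sup_{a ∈ A} (z·a − p(a))`. -/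
def fitz (A : Set (E × (E →L[ℝ] ℝ))) (z : E × (E →L[ℝ] ℝ)) : EReal :=
  ⨆ a ∈ A, ((dprod z a - pairing a : ℝ) : EReal)

/-- Conjugate with respect to the natural dual product. -/
def econj (g : E × (E →L[ℝ] ℝ) → EReal) (w : E × (E →L[ℝ] ℝ)) : EReal :=
  ⨆ z, ((dprod w z : ℝ) : EReal) - g z

/-- Penot function `φ_A = (h_A)*`. -/
def penot (A : Set (E × (E →L[ℝ] ℝ))) : E × (E →L[ℝ] ℝ) → EReal := econj (fitz A)

/-- Domain of a multivalued operator. -/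
def opDom (A : Set (E × (E →L[ℝ] ℝ))) : Set E := {x | ∃ u, (x, u) ∈ A}

/-- Sum of multivalued operators: `A + B = {(x, u+v) : (x,u) ∈ A, (x,v) ∈ B}`. -/
def opSum (A B : Set (E × (E →L[ℝ] ℝ))) : Set (E × (E →L[ℝ] ℝ)) :=
  {z | ∃ u v, (z.1, u) ∈ A ∧ (z.1, v) ∈ B ∧ z.2 = u + v}

/-- Convexity for extended-real-valued functions. -/
def EConvex (h : E × (E →L[ℝ] ℝ) → EReal) : Prop :=
  ∀ z w : E × (E →L[ℝ] ℝ), ∀ a b : ℝ, 0 ≤ a → 0 ≤ b → a + b = 1 →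
    h (a • z + b • w) ≤ (a : EReal) * h z + (b : EReal) * h w

/-- The adjoint `L* y* = y* ∘ L`. -/
def adjoint (L : E →L[ℝ] F) (g : F →L[ℝ] ℝ) : E →L[ℝ] ℝ := g.comp L

/-- The composition `L* M L = {(x, L* y*) : (Lx, y*) ∈ M}`. -/
def opComp (L : E →L[ℝ] F) (M : Set (F × (F →L[ℝ] ℝ))) : Set (E × (E →L[ℝ] ℝ)) :=
  {z | ∃ g, (L z.1, g) ∈ M ∧ z.2 = adjoint L g}

/-- Normal cone operator of a set `C`. -/
def normalCone (C : Set E) : Set (E × (E →L[ℝ] ℝ)) :=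
  {z | z.1 ∈ C ∧ ∀ v ∈ C, z.2 (v - z.1) ≤ 0}

/-- `0 ∈ ⁱS`: the union `⋃_{n ≥ 1} n • S` is a linear subspace. -/
def ZeroInRAI {G : Type*} [AddCommGroup G] [Module ℝ G] (S : Set G) : Prop :=
  ∃ W : Submodule ℝ G, (W : Set G) = ⋃ (n : ℕ) (_ : 1 ≤ n), (n : ℝ) • S

/-- `0 ∈ ^{ic}S`: the union `⋃_{n ≥ 1} n • S` is a closed linear subspace. -/
def ZeroInIC {G : Type*} [AddCommGroup G] [Module ℝ G] [TopologicalSpace G] (S : Set G) : Prop :=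
  ∃ W : Submodule ℝ G, ((W : Set G) = ⋃ (n : ℕ) (_ : 1 ≤ n), (n : ℝ) • S) ∧ IsClosed (W : Set G)

end

/-- If `A ⊆ Z` is monotone with `D(A) = X`, then `h_A ≥ p` everywhere and
`{h_A = p}` is the unique maximal monotone extension of `A`: it is maximal monotone, contains
`A`, and every maximal monotone set containing `A` equals it. -/
theorem fitz_NI_and_unique_maximal_extension_of_fullDomain {X : Type*} [NormedAddCommGroup X]
    [NormedSpace ℝ X] (A : Set (X × (X →L[ℝ] ℝ))) (hmono : MonotoneSet A)
    (hdom : opDom A = Set.univ) :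
    (∀ z : X × (X →L[ℝ] ℝ), (pairing z : EReal) ≤ fitz A z) ∧
      MaximalMonotoneSet {z | fitz A z = (pairing z : EReal)} ∧
      A ⊆ {z | fitz A z = (pairing z : EReal)} ∧
      (∀ B, MaximalMonotoneSet B → A ⊆ B → B = {z | fitz A z = (pairing z : EReal)}) := by
  have hge : ∀ z : X × (X →L[ℝ] ℝ), (pairing z : EReal) ≤ fitz A z := by
    intro z
    have hz : z.1 ∈ opDom A := by rw [hdom]; trivial
    obtain ⟨u, hu⟩ := hz
    have h1 : pairing z = dprod z (z.1, u) - pairing (z.1, u) := by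
      simp [pairing, dprod]
    rw [h1]
    exact le_iSup₂_of_le (z.1, u) hu le_rfl
  have hiff : ∀ z : X × (X →L[ℝ] ℝ), fitz A z = (pairing z : EReal) ↔
      ∀ a ∈ A, 0 ≤ (z.2 - a.2) (z.1 - a.1) := by
    intro z
    have key : fitz A z = (pairing z : EReal) ↔ fitz A z ≤ (pairing z : EReal) :=
      ⟨fun h => h.le, fun h => le_antisymm h (hge z)⟩
    rw [key, fitz, iSup₂_le_iff]
    refine forall₂_congr fun a _ => ?_
    rw [EReal.coe_le_coe_iff]
    simp only [dprod, pairing, map_sub, sub_apply, ContinuousLinearMap.sub_apply]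
    constructor <;> intro h <;> linarith
  have hM : MonotoneSet {z | fitz A z = (pairing z : EReal)} := by
    intro z hz w hw
    have hz := (hiff z).1 hz
    have hw := (hiff w).1 hw
    have hm : (1/2 : ℝ) • (z.1 + w.1) ∈ opDom A := by rw [hdom]; trivial
    obtain ⟨u, hu⟩ := hm
    have h1 := hz _ hu
    have h2 := hw _ hu
    simp only [map_sub, map_add, map_smul, smul_eq_mul, ContinuousLinearMap.sub_apply] at h1 h2 ⊢
    linarith
  have hsub : ∀ B, MonotoneSet B → A ⊆ B → B ⊆ {z | fitz A z = (pairing z : EReal)} :=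
    fun B hB hAB z hz => (hiff z).2 fun a ha => hB z hz a (hAB ha)
  have hA := hsub A hmono subset_rfl
  exact ⟨hge, ⟨hM, fun B hB h => h.antisymm (hsub B hB (hA.trans h))⟩, hA,
    fun B hB hAB => hB.2 _ hM (hsub B hB.1 hAB)⟩
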